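/- Let E be a Banach space, n ≥ 2, and suppose there is a bounded net (K_α) of compact operators on E with (i) K_α*γ → γ for all γ ∈ E*, and (ii) for all ε > 0 and all α₀ there is α > α₀ with ‖K_α x‖ⁿ + ‖x − K_α x‖ⁿ ≤ (1+ε)‖x‖ⁿ for all x ∈ E. If moreover P_w(ⁿE) = P_{w0}(ⁿE), then P_w(ⁿE) is an M-ideal in P(ⁿE). -/

import Mathlib

open Filter Topology

universe u v

section PolyDefs

variable {E : Type u} [NormedAddCommGroup E] [NormedSpace ℝ E]

/-- `P` is a continuous `n`-homogeneous scalar polynomial on `E`. -/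
def IsHomogPoly (n : ℕ) (P : E → ℝ) : Prop :=
  ∃ M : ContinuousMultilinearMap ℝ (fun _ : Fin n => E) ℝ, ∀ x, P x = M (fun _ => x)

/-- The polynomial (sup) norm: `‖P‖ = sup_{‖x‖ ≤ 1} |P x|`. -/
noncomputable def polyNorm (P : E → ℝ) : ℝ :=
  sSup {r : ℝ | ∃ x : E, ‖x‖ ≤ 1 ∧ r = |P x|}

/-- A net is (norm) bounded. -/
def BoundedNet {ι : Type v} (x : ι → E) : Prop := ∃ C : ℝ, ∀ i, ‖x i‖ ≤ C

/-- The net `x` converges weakly to `x₀` along the filter `l`. -/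
def WeaklyTendsto {ι : Type v} (x : ι → E) (l : Filter ι) (x₀ : E) : Prop :=
  ∀ γ : E →L[ℝ] ℝ, Tendsto (fun i => γ (x i)) l (𝓝 (γ x₀))

/-- `P` is weakly continuous on bounded sets at the point `x₀`. -/
def WCBat (P : E → ℝ) (x₀ : E) : Prop :=
  ∀ (ι : Type u) (l : Filter ι), l.NeBot → ∀ x : ι → E,
    BoundedNet x → WeaklyTendsto x l x₀ → Tendsto (fun i => P (x i)) l (𝓝 (P x₀))

/-- `P ∈ P_w(ⁿE)`: continuous `n`-homogeneous and weakly continuous on bounded sets. -/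
def WCB (n : ℕ) (P : E → ℝ) : Prop := IsHomogPoly n P ∧ ∀ x₀ : E, WCBat P x₀

/-- `P ∈ P_{w0}(ⁿE)`: weakly continuous on bounded sets at `0`. -/
def WCB0 (n : ℕ) (P : E → ℝ) : Prop := IsHomogPoly n P ∧ WCBat P 0

end PolyDefs

/-- `P_w(ⁿE)` is an M-ideal in `P(ⁿE)`, via the 3-ball property
([HWW, Theorem I.2.2 (iv)]). -/
def PolyMIdeal (n : ℕ) (E : Type u) [NormedAddCommGroup E] [NormedSpace ℝ E] : Prop :=
  ∀ P₁ P₂ P₃ Q : E → ℝ, WCB n P₁ → WCB n P₂ → WCB n P₃ →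
    polyNorm P₁ ≤ 1 → polyNorm P₂ ≤ 1 → polyNorm P₃ ≤ 1 →
    IsHomogPoly n Q → polyNorm Q ≤ 1 → ∀ ε : ℝ, 0 < ε →
    ∃ P : E → ℝ, WCB n P ∧ polyNorm (fun x => Q x + P₁ x - P x) ≤ 1 + ε ∧
      polyNorm (fun x => Q x + P₂ x - P x) ≤ 1 + ε ∧
      polyNorm (fun x => Q x + P₃ x - P x) ≤ 1 + ε

section PolyLemmas

variable {E : Type u} [NormedAddCommGroup E]

/-- `f` has degree at most `d`: all its `(d + 1)`-fold differences vanish. -/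
def DegreeLE : ℕ → (E → ℝ) → Prop
  | 0, f => ∀ x y, f x = f y
  | d + 1, f => ∀ h, DegreeLE d (fun x => f (x + h) - f x)

lemma DegreeLE.zero (d : ℕ) : DegreeLE d (fun _ : E => 0) := by
  induction d with
  | zero => intro _ _; rfl
  | succ d ih => intro h; simpa using ih

lemma DegreeLE.add {d : ℕ} {f g : E → ℝ} (hf : DegreeLE d f) (hg : DegreeLE d g) :
    DegreeLE d (fun x => f x + g x) := by
  induction d generalizing f g with
  | zero => intro x y; simp only [hf x y, hg x y]
  | succ d ih =>
    intro h
    convert ih (hf h) (hg h) using 2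
    ring

lemma DegreeLE.sum {d : ℕ} {κ : Type*} (s : Finset κ) {f : κ → E → ℝ}
    (hf : ∀ k ∈ s, DegreeLE d (f k)) : DegreeLE d (fun x => ∑ k ∈ s, f k x) := by
  classical
  induction s using Finset.induction_on with
  | empty => simpa using DegreeLE.zero d
  | insert a s ha ih =>
    simp only [Finset.sum_insert ha]
    exact (hf a (by simp)).add (ih fun k hk => hf k (by simp [hk]))

lemma BoundedNet.add {ι : Type*} {x y : ι → E} (hx : BoundedNet x) (hy : BoundedNet y) :
    BoundedNet (fun i => x i + y i) := by
  obtain ⟨C, hC⟩ := hx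
  obtain ⟨D, hD⟩ := hy
  exact ⟨C + D, fun i => (norm_add_le _ _).trans (add_le_add (hC i) (hD i))⟩

lemma boundedNet_const {ι : Type*} (a : E) : BoundedNet (fun _ : ι => a) :=
  ⟨‖a‖, fun _ => le_rfl⟩

lemma BoundedNet.neg {ι : Type*} {x : ι → E} (hx : BoundedNet x) :
    BoundedNet (fun i => - x i) := by
  simpa [BoundedNet] using hx

lemma BoundedNet.comp {ι κ : Type*} {x : ι → E} (hx : BoundedNet x) (g : κ → ι) :
    BoundedNet (fun k => x (g k)) :=
  hx.imp fun _ hC k => hC (g k)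

lemma polyNorm_le {f : E → ℝ} {c : ℝ} (hc : 0 ≤ c) (h : ∀ x : E, ‖x‖ ≤ 1 → |f x| ≤ c) :
    polyNorm f ≤ c := by
  refine Real.sSup_le ?_ hc
  rintro _ ⟨x, hx, rfl⟩
  exact h x hx

variable [NormedSpace ℝ E]

lemma degreeLE_multilinear_diagonal (d : ℕ) {κ : Type} [Fintype κ]
    (M : MultilinearMap ℝ (fun _ : κ => E) ℝ) (hd : Fintype.card κ ≤ d) :
    DegreeLE d (fun x => M fun _ => x) := by
  classical
  induction d generalizing κ with
  | zero =>
    have : IsEmpty κ := Fintype.card_eq_zero_iff.1 (by omega)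
    intro x y
    exact congrArg M (Subsingleton.elim _ _)
  | succ d ih =>
    intro h
    have key : (fun x : E => M (fun _ => x + h) - M fun _ => x) =
        fun x => ∑ s ∈ Finset.univ.erase Finset.univ,
          M.domDomRestrict (fun i => i ∈ s) (fun _ => h) (fun _ => x) := by
      funext x
      have := M.map_add_univ (fun _ => x) (fun _ => h)
      rw [← Finset.add_sum_erase _ _ (Finset.mem_univ Finset.univ)] at this
      simp only [Finset.piecewise_univ] at this
      change M ((fun _ => x) + fun _ => h) - _ = _
      rw [this, add_sub_cancel_left]
      refine Finset.sum_congr rfl fun s _ => ?_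
      rw [MultilinearMap.domDomRestrict_apply]
      rfl
    rw [key]
    refine DegreeLE.sum _ fun s hs => ih _ ?_
    have hlt : s.card < Fintype.card κ :=
      Finset.card_lt_card (Finset.ssubset_univ_iff.2 (Finset.ne_of_mem_erase hs))
    rw [Fintype.card_coe]
    omega

lemma IsHomogPoly.degreeLE {n : ℕ} {P : E → ℝ} (hP : IsHomogPoly n P) : DegreeLE n P := by
  obtain ⟨M, hM⟩ := hP
  rw [funext hM]
  exact degreeLE_multilinear_diagonal n M.toMultilinearMap (by simp)

lemma WeaklyTendsto.add {ι : Type*} {l : Filter ι} {x y : ι → E} {a b : E}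
    (hx : WeaklyTendsto x l a) (hy : WeaklyTendsto y l b) :
    WeaklyTendsto (fun i => x i + y i) l (a + b) := fun γ => by
  simpa using (hx γ).add (hy γ)

lemma weaklyTendsto_const {ι : Type*} (l : Filter ι) (a : E) :
    WeaklyTendsto (fun _ : ι => a) l a := fun _ => tendsto_const_nhds

/-- Weak continuity on bounded sets may be tested on nets indexed by a type in any universe. -/
lemma WCBat.tendsto {P : E → ℝ} {x₀ : E} (hP : WCBat P x₀) {ι : Type*} {l : Filter ι}
    {x : ι → E} (hb : BoundedNet x) (hx : WeaklyTendsto x l x₀) :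
    Tendsto (fun i => P (x i)) l (𝓝 (P x₀)) := by
  rcases l.eq_or_neBot with rfl | hl
  · exact tendsto_bot
  obtain ⟨C, hC⟩ := hb
  let g : ι → {z : E // ‖z‖ ≤ C} := fun i => ⟨x i, hC i⟩
  have := hP {z : E // ‖z‖ ≤ C} (l.map g) inferInstance (fun z => z.1) ⟨C, fun z => z.2⟩
    fun γ => tendsto_map'_iff.2 (hx γ)
  exact tendsto_map'_iff.1 this

/-- A finite-degree function which is weakly continuous on bounded sets is uniformly so. -/
lemma DegreeLE.tendsto_sub_ultrafilter {d : ℕ} {f : E → ℝ} (hf : DegreeLE d f)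
    (hw : ∀ a, WCBat f a) {ι : Type*} (U : Ultrafilter ι) {x y : ι → E}
    (hx : BoundedNet x) (hy : BoundedNet y) (hx0 : WeaklyTendsto x U 0) :
    Tendsto (fun i => f (y i + x i) - f (y i)) U (𝓝 0) := by
  induction d generalizing f with
  | zero => simp [fun i => hf (y i + x i) (y i)]
  | succ d ih =>
    have hdiff : ∀ h, Tendsto (fun i => (f (y i + x i + h) - f (y i + x i))
        - (f (y i + h) - f (y i))) U (𝓝 0) := fun h => by
      refine ih (hf h) fun a κ l hl z hz hza => ?_
      exact ((hw (a + h)).tendsto (hz.add (boundedNet_const h))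
        (hza.add (weaklyTendsto_const l h))).sub ((hw a).tendsto hz hza)
    let F : Filter (ι × ι) := (U : Filter ι).curry U
    have hle : F ≤ (U : Filter ι) ×ˢ U := curry_le_prod
    have hz0 : WeaklyTendsto (fun p : ι × ι => y p.2 + -y p.1) F 0 := by
      intro γ
      obtain ⟨C, hC⟩ := hy
      have hmem : ∀ i, γ (y i) ∈ Metric.closedBall (0 : ℝ) (‖γ‖ * C) := fun i => by
        rw [mem_closedBall_zero_iff]
        exact (γ.le_opNorm _).trans (mul_le_mul_of_nonneg_left (hC i) (norm_nonneg _))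
      obtain ⟨L, -, hL⟩ := (isCompact_closedBall (0 : ℝ) (‖γ‖ * C)).ultrafilter_le_nhds
        (U.map fun i => γ (y i)) (by
          rw [le_principal_iff, Ultrafilter.mem_coe, Ultrafilter.mem_map]
          exact Filter.univ_mem' hmem)
      have hL : Tendsto (fun i => γ (y i)) U (𝓝 L) := hL
      have := ((hL.comp tendsto_snd).sub (hL.comp tendsto_fst)).mono_left hle
      simpa [sub_eq_add_neg] using this
    have hzb : BoundedNet (fun p : ι × ι => y p.2 + -y p.1) :=
      (hy.comp Prod.snd).add (hy.comp Prod.fst).neg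
    have hxF : WeaklyTendsto (fun p : ι × ι => x p.2) F 0 := fun γ =>
      ((hx0 γ).comp tendsto_snd).mono_left hle
    have h1 : Tendsto (fun p : ι × ι => f (y p.2 + -y p.1 + x p.2) - f (y p.2 + -y p.1)) F
        (𝓝 0) := by
      have h2 := (hw (0 + 0)).tendsto (hzb.add (hx.comp Prod.snd)) (hz0.add hxF)
      simpa using h2.sub ((hw 0).tendsto hzb hz0)
    rw [Metric.tendsto_nhds] at h1 ⊢
    intro ε hε
    obtain ⟨b, hb⟩ := (eventually_curry_iff.1 (h1 (ε / 2) (by positivity))).exists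
    filter_upwards [hb, Metric.tendsto_nhds.1 (hdiff (-y b)) (ε / 2) (by positivity)] with i h3 h4
    rw [Real.dist_0_eq_abs, abs_lt] at *
    rw [add_right_comm] at h3
    constructor <;> linarith [h3.1, h3.2, h4.1, h4.2]

lemma WCB.tendsto_sub {n : ℕ} {P : E → ℝ} (hP : WCB n P) {ι : Type*} {l : Filter ι} {x y : ι → E}
    (hx : BoundedNet x) (hy : BoundedNet y) (hx0 : WeaklyTendsto x l 0) :
    Tendsto (fun i => P (y i + x i) - P (y i)) l (𝓝 0) := by
  rw [tendsto_iff_ultrafilter]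
  exact fun U hU => hP.1.degreeLE.tendsto_sub_ultrafilter hP.2 U hx hy
    fun γ => (hx0 γ).mono_left hU

lemma WCB.eventually_abs_sub_comp_le {n : ℕ} {P : E → ℝ} (hP : WCB n P) {ι : Type*}
    {l : Filter ι} {K : ι → E →L[ℝ] E} (hb : ∃ C : ℝ, ∀ i, ‖K i‖ ≤ C)
    (hadj : ∀ γ : E →L[ℝ] ℝ, Tendsto (fun i => ‖γ.comp (K i) - γ‖) l (𝓝 0))
    {ε : ℝ} (hε : 0 < ε) :
    ∀ᶠ i in l, ∀ x : E, ‖x‖ ≤ 1 → |P x - P (K i x)| ≤ ε := by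
  have hex : ∀ i, ∃ x : E, ‖x‖ ≤ 1 ∧
      (|P x - P (K i x)| ≤ ε → ∀ z : E, ‖z‖ ≤ 1 → |P z - P (K i z)| ≤ ε) := fun i => by
    by_cases h : ∀ z : E, ‖z‖ ≤ 1 → |P z - P (K i z)| ≤ ε
    · exact ⟨0, by simp, fun _ => h⟩
    · push Not at h
      obtain ⟨z, hz, hlt⟩ := h
      exact ⟨z, hz, fun h' => absurd h' (not_le.2 hlt)⟩
  choose x hx1 hx using hex
  obtain ⟨C, hC⟩ := hb
  have hxb : BoundedNet x := ⟨1, hx1⟩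
  have hKb : BoundedNet (fun i => K i (x i)) := ⟨C * 1, fun i =>
    ((K i).le_opNorm _).trans
      (mul_le_mul (hC i) (hx1 i) (norm_nonneg _) ((norm_nonneg _).trans (hC i)))⟩
  have hweak : WeaklyTendsto (fun i => K i (x i) + -x i) l 0 := by
    intro γ
    rw [map_zero]
    refine squeeze_zero_norm (fun i => ?_) (hadj γ)
    have := (γ.comp (K i) - γ).le_opNorm_of_le (hx1 i)
    simpa [sub_eq_add_neg] using this
  have := hP.tendsto_sub (hKb.add hxb.neg) hxb hweak
  filter_upwards [Metric.tendsto_nhds.1 this ε hε] with i hi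
  refine hx i ?_
  rw [Real.dist_0_eq_abs, abs_sub_comm] at hi
  simpa using hi.le

lemma tendsto_compact_of_weaklyTendsto_zero {T : E →L[ℝ] E} (hT : IsCompactOperator T)
    {ι : Type*} {l : Filter ι} {x : ι → E} (hb : BoundedNet x) (hx : WeaklyTendsto x l 0) :
    Tendsto (fun i => T (x i)) l (𝓝 0) := by
  rw [tendsto_iff_ultrafilter]
  intro U hU
  obtain ⟨C, hC⟩ := hb
  have hcpt := hT.isCompact_closure_image_closedBall C
  obtain ⟨z, -, hz⟩ := hcpt.ultrafilter_le_nhds (U.map fun i => T (x i)) (by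
    rw [le_principal_iff, Ultrafilter.mem_coe, Ultrafilter.mem_map]
    exact Filter.univ_mem' fun i =>
      subset_closure ⟨x i, by simpa using hC i, rfl⟩)
  have hz : Tendsto (fun i => T (x i)) U (𝓝 z) := hz
  suffices z = 0 by rwa [this] at hz
  refine SeparatingDual.eq_zero_of_forall_dual_eq_zero (R := ℝ) fun γ => ?_
  have h1 := (γ.continuous.tendsto z).comp hz
  have h2 := (hx (γ.comp T)).mono_left hU
  rw [map_zero] at h2
  exact tendsto_nhds_unique h1 h2

lemma IsHomogPoly.sub_comp {n : ℕ} {Q : E → ℝ} (hQ : IsHomogPoly n Q) (T : E →L[ℝ] E) :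
    IsHomogPoly n (fun x => Q x - Q (x - T x)) := by
  obtain ⟨M, hM⟩ := hQ
  refine ⟨M - M.compContinuousLinearMap fun _ => ContinuousLinearMap.id ℝ E - T, fun x => ?_⟩
  simp [hM]

lemma IsHomogPoly.wcb0_sub_comp {n : ℕ} {Q : E → ℝ} (hQ : IsHomogPoly n Q) {T : E →L[ℝ] E}
    (hT : IsCompactOperator T) : WCB0 n (fun x => Q x - Q (x - T x)) := by
  refine ⟨hQ.sub_comp T, fun ι l _ x hb hx => ?_⟩
  obtain ⟨M, hM⟩ := hQ
  have hTx := tendsto_compact_of_weaklyTendsto_zero hT hb hx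
  obtain ⟨C, hC⟩ := hb
  simp only [map_zero, sub_self]
  set R := max C (C + ‖T‖ * C)
  refine squeeze_zero_norm (a := fun i => ‖M‖ * n * R ^ (n - 1) * ‖T (x i)‖) (fun i => ?_) ?_
  · have hsub : ‖x i - T (x i)‖ ≤ C + ‖T‖ * C :=
      (norm_sub_le _ _).trans (add_le_add (hC i) (T.le_opNorm_of_le (hC i)))
    rw [hM, hM]
    refine (M.norm_image_sub_le _ _).trans ?_
    have hR : 0 ≤ R := ((norm_nonneg _).trans (hC i)).trans (le_max_left _ _)
    rw [Fintype.card_fin]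
    gcongr
    · exact max_le ((pi_norm_le_iff_of_nonneg hR).2 fun _ => (hC i).trans (le_max_left _ _))
        ((pi_norm_le_iff_of_nonneg hR).2 fun _ => hsub.trans (le_max_right _ _))
    · refine (pi_norm_le_iff_of_nonneg (norm_nonneg _)).2 fun _ => ?_
      simp
  · simpa using (hTx.norm).const_mul (‖M‖ * n * R ^ (n - 1))

lemma IsHomogPoly.abs_le {n : ℕ} (hn : n ≠ 0) {P : E → ℝ} (hP : IsHomogPoly n P)
    (h1 : polyNorm P ≤ 1) (x : E) : |P x| ≤ ‖x‖ ^ n := by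
  obtain ⟨M, hM⟩ := hP
  rcases eq_or_ne x 0 with rfl | hx
  · have : Nonempty (Fin n) := ⟨⟨0, Nat.pos_of_ne_zero hn⟩⟩
    have : M (fun _ => (0 : E)) = 0 := M.map_zero
    simp [hM, this]
  have hpos : 0 < ‖x‖ := norm_pos_iff.2 hx
  have hbdd : BddAbove {r : ℝ | ∃ x : E, ‖x‖ ≤ 1 ∧ r = |P x|} := by
    refine ⟨‖M‖, ?_⟩
    rintro _ ⟨z, hz, rfl⟩
    rw [hM, ← Real.norm_eq_abs]
    exact M.unit_le_opNorm ((pi_norm_le_iff_of_nonneg zero_le_one).2 fun _ => hz)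
  have hle : |P (‖x‖⁻¹ • x)| ≤ 1 :=
    (le_csSup hbdd ⟨_, by rw [norm_smul, norm_inv, norm_norm, inv_mul_cancel₀ hpos.ne'], rfl⟩).trans
      h1
  have hsm : P x = ‖x‖ ^ n * P (‖x‖⁻¹ • x) := by
    have := M.map_smul_univ (fun _ => ‖x‖) (fun _ => ‖x‖⁻¹ • x)
    simp only [smul_inv_smul₀ hpos.ne'] at this
    simpa [hM] using this
  rw [hsm, abs_mul, abs_of_nonneg (by positivity)]
  exact mul_le_of_le_one_right (by positivity) hle

end PolyLemmas

/-- Sufficient condition for `P_w(ⁿE)` to be an M-ideal in `P(ⁿE)` via a bounded net of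
compact operators (Proposition 2.2). -/
theorem stmt12 {E : Type u} [NormedAddCommGroup E] [NormedSpace ℝ E]
    (n : ℕ) (hn : 2 ≤ n)
    (ι : Type v) [Nonempty ι] [SemilatticeSup ι]
    (K : ι → E →L[ℝ] E) (hb : ∃ C : ℝ, ∀ i, ‖K i‖ ≤ C)
    (hcpt : ∀ i, IsCompactOperator (K i))
    (hadj : ∀ γ : E →L[ℝ] ℝ, Tendsto (fun i => ‖γ.comp (K i) - γ‖) atTop (𝓝 0))
    (hsplit : ∀ ε : ℝ, 0 < ε → ∀ i₀ : ι, ∃ i, i₀ ≤ i ∧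
      ∀ x : E, ‖K i x‖ ^ n + ‖x - K i x‖ ^ n ≤ (1 + ε) * ‖x‖ ^ n)
    (hw : ∀ P : E → ℝ, WCB0 n P → WCB n P) :
    PolyMIdeal n E := by
  intro P₁ P₂ P₃ Q h₁ h₂ h₃ n₁ n₂ n₃ hQ nQ ε hε
  have hn0 : n ≠ 0 := by omega
  have hε2 : 0 < ε / 2 := by positivity
  obtain ⟨i₀, hi₀⟩ := eventually_atTop.1
    ((h₁.eventually_abs_sub_comp_le hb hadj hε2).and
      ((h₂.eventually_abs_sub_comp_le hb hadj hε2).and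
        (h₃.eventually_abs_sub_comp_le hb hadj hε2)))
  obtain ⟨i, hi, hK⟩ := hsplit (ε / 2) hε2 i₀
  have key : ∀ R : E → ℝ, WCB n R → polyNorm R ≤ 1 →
      (∀ x : E, ‖x‖ ≤ 1 → |R x - R (K i x)| ≤ ε / 2) →
      polyNorm (fun x => Q x + R x - (Q x - Q (x - K i x))) ≤ 1 + ε := by
    intro R hR nR hRK
    refine polyNorm_le (by positivity) fun x hx => ?_
    have hpow : (1 + ε / 2) * ‖x‖ ^ n ≤ (1 + ε / 2) * 1 :=
      mul_le_mul_of_nonneg_left (pow_le_one₀ (norm_nonneg _) hx) (by positivity)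
    calc |Q x + R x - (Q x - Q (x - K i x))|
        = |(R x - R (K i x)) + R (K i x) + Q (x - K i x)| := by congr 1; ring
      _ ≤ |R x - R (K i x)| + |R (K i x)| + |Q (x - K i x)| := abs_add_three _ _ _
      _ ≤ 1 + ε := by
        linarith [hK x, hRK x hx, hR.1.abs_le hn0 nR (K i x), hQ.abs_le hn0 nQ (x - K i x)]
  obtain ⟨a₁, a₂, a₃⟩ := hi₀ i hi
  exact ⟨_, hw _ (hQ.wcb0_sub_comp (hcpt i)), key P₁ h₁ n₁ a₁, key P₂ h₂ n₂ a₂, key P₃ h₃ n₃ a₃⟩
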